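/- arXiv:0905.2150 — 2 statements merged into one kernel-verified Lean document; each statement's English description precedes it below -/
import Mathlib

section
/- There exists a constant $b_H>0$ depending only on $H$ such that for every $T>0$, every Banach space $V$, and every strongly measurable function $\phi:[0,T]\to V$ with $\int_0^T \|\phi(t)\|_V^{1/H}\,dt<\infty$, one has $H(2H-1)\int_0^T\int_0^T \|\phi(t)\|_V\,\|\phi(s)\|_V\,|t-s|^{2H-2}\,ds\,dt \;\le\; b_H^2\left(\int_0^T \|\phi(t)\|_V^{1/H}\,dt\right)^{2H}.$ -/
open MeasureTheory ENNReal

/-- The integral of the power kernel `|x| ^ p` with `-1 < p` over a centred interval. -/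
lemma lintegral_ball_abs_rpow_le {p : ℝ} (hp : -1 < p) {r : ℝ} (hr : 0 < r) (s : ℝ) :
    ∫⁻ t in Metric.ball s r, ENNReal.ofReal (|t - s| ^ p) ≤
      ENNReal.ofReal (2 / (p + 1) * r ^ (p + 1)) := by
  have hp1 : 0 < p + 1 := by linarith
  have hright : ∫⁻ x in Set.Ioc 0 r, ENNReal.ofReal (|x| ^ p) =
      ENNReal.ofReal (r ^ (p + 1) / (p + 1)) := by
    have hint := intervalIntegral.intervalIntegrable_rpow' (a := 0) (b := r) hp
    rw [intervalIntegrable_iff_integrableOn_Ioc_of_le hr.le] at hint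
    rw [setLIntegral_congr_fun (g := fun x => ENNReal.ofReal (x ^ p)) measurableSet_Ioc
      (fun x hx => by simp only [abs_of_pos hx.1]),
      ← ofReal_integral_eq_lintegral_ofReal hint, ← intervalIntegral.integral_of_le hr.le,
      integral_rpow (Or.inl hp), Real.zero_rpow hp1.ne', sub_zero]
    filter_upwards [self_mem_ae_restrict measurableSet_Ioc] with x hx
    exact Real.rpow_nonneg hx.1.le _
  have hleft : ∫⁻ x in Set.Ico (-r) 0, ENNReal.ofReal (|x| ^ p) =
      ENNReal.ofReal (r ^ (p + 1) / (p + 1)) := by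
    rw [← hright]
    have h := (Measure.measurePreserving_neg (volume : Measure ℝ)).setLIntegral_comp_preimage_emb
      (MeasurableEquiv.neg ℝ).measurableEmbedding
      (fun x => ENNReal.ofReal (|x| ^ p)) (Set.Ioc 0 r)
    simpa [abs_neg] using h
  have hshift : ∫⁻ t in Metric.ball s r, ENNReal.ofReal (|t - s| ^ p) =
      ∫⁻ x in Metric.ball 0 r, ENNReal.ofReal (|x| ^ p) := by
    have h := (measurePreserving_sub_right (volume : Measure ℝ) s).setLIntegral_comp_preimage_emb
      (MeasurableEquiv.subRight s).measurableEmbedding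
      (fun x => ENNReal.ofReal (|x| ^ p)) (Metric.ball 0 r)
    rw [← h]
    congr 2
    ext x
    simp [Real.dist_eq]
  have hsub : Metric.ball (0 : ℝ) r ⊆ (Set.Ico (-r) 0 ∪ {0}) ∪ Set.Ioc 0 r := by
    intro x hx
    rw [Real.ball_eq_Ioo] at hx
    rcases lt_trichotomy x 0 with h | h | h
    · exact Or.inl (Or.inl ⟨by linarith [hx.1], h⟩)
    · exact Or.inl (Or.inr h)
    · exact Or.inr ⟨h, by linarith [hx.2]⟩
  rw [hshift]
  calc ∫⁻ x in Metric.ball 0 r, ENNReal.ofReal (|x| ^ p)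
      ≤ ∫⁻ x in (Set.Ico (-r) 0 ∪ {0}) ∪ Set.Ioc 0 r, ENNReal.ofReal (|x| ^ p) :=
        lintegral_mono_set hsub
    _ ≤ ((∫⁻ x in Set.Ico (-r) 0, ENNReal.ofReal (|x| ^ p)) +
          ∫⁻ x in {0}, ENNReal.ofReal (|x| ^ p)) +
          ∫⁻ x in Set.Ioc 0 r, ENNReal.ofReal (|x| ^ p) :=
        (lintegral_union_le _ _ _).trans (add_le_add_left (lintegral_union_le _ _ _) _)
    _ = ENNReal.ofReal (2 / (p + 1) * r ^ (p + 1)) := by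
        rw [hleft, hright, setLIntegral_measure_zero _ _ (by simp), add_zero,
          ← ENNReal.ofReal_add (by positivity) (by positivity)]
        congr 1
        ring

/-- Among sets of given measure, the integral of `|t - s| ^ p` is controlled by that over an
interval centred at `s`. -/
lemma setLIntegral_abs_sub_rpow_le {μ : Measure ℝ} (hμ : μ ≤ volume) {p : ℝ} (hp : -1 < p)
    (hp0 : p ≤ 0) (s : ℝ) {A : Set ℝ} (hA : μ A ≠ ∞) :
    ∫⁻ t in A, ENNReal.ofReal (|t - s| ^ p) ∂μ ≤
      ENNReal.ofReal ((2 / (p + 1) + 1) * (μ A).toReal ^ (p + 1)) := by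
  have hp1 : 0 < p + 1 := by linarith
  rcases eq_or_ne (μ A) 0 with h0 | h0
  · simp [setLIntegral_measure_zero _ _ h0]
  set r := (μ A).toReal with hr
  have hr0 : 0 < r := ENNReal.toReal_pos h0 hA
  have hnear : ∫⁻ t in A ∩ Metric.ball s r, ENNReal.ofReal (|t - s| ^ p) ∂μ ≤
      ENNReal.ofReal (2 / (p + 1) * r ^ (p + 1)) :=
    (lintegral_mono' (Measure.restrict_mono Set.inter_subset_right hμ) le_rfl).trans
      (lintegral_ball_abs_rpow_le hp hr0 s)
  have hfar : ∫⁻ t in A \ Metric.ball s r, ENNReal.ofReal (|t - s| ^ p) ∂μ ≤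
      ENNReal.ofReal (r ^ (p + 1)) := by
    calc ∫⁻ t in A \ Metric.ball s r, ENNReal.ofReal (|t - s| ^ p) ∂μ
        ≤ ∫⁻ _ in A \ Metric.ball s r, ENNReal.ofReal (r ^ p) ∂μ := by
          refine setLIntegral_mono measurable_const fun t ht => ?_
          have h : r ≤ |t - s| := by simpa [Real.dist_eq] using ht.2
          exact ENNReal.ofReal_le_ofReal (Real.rpow_le_rpow_of_nonpos hr0 h hp0)
      _ ≤ ENNReal.ofReal (r ^ p) * μ A := by
          rw [setLIntegral_const]
          gcongr
          exact Set.sdiff_subset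
      _ = ENNReal.ofReal (r ^ (p + 1)) := by
          rw [← ENNReal.ofReal_toReal hA, ← ENNReal.ofReal_mul (by positivity),
            Real.rpow_add hr0, Real.rpow_one]
  rw [← lintegral_inter_add_sdiff _ A (measurableSet_ball (x := s) (ε := r))]
  refine (add_le_add hnear hfar).trans_eq ?_
  rw [← ENNReal.ofReal_add (by positivity) (by positivity)]
  congr 1
  ring

/-- Truncated fractional integral bound: layer-cake decomposition of `min f b` combined with
Chebyshev's inequality for the level sets of `f`. -/
lemma lintegral_min_mul_abs_sub_rpow_le {μ : Measure ℝ} (hμ : μ ≤ volume) {H : ℝ}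
    (hH : H ∈ Set.Ioo (1 / 2 : ℝ) 1) {f : ℝ → ℝ} (hf : Measurable f) (hf0 : ∀ t, 0 ≤ f t)
    (hint : Integrable (fun t => f t ^ (1 / H)) μ) (s : ℝ) {b : ℝ} (hb : 0 ≤ b) :
    ∫⁻ t, ENNReal.ofReal (|t - s| ^ (2 * H - 2)) * ENNReal.ofReal (min (f t) b) ∂μ ≤
      ENNReal.ofReal ((2 / (2 * H - 1) + 1) * (∫ t, f t ^ (1 / H) ∂μ) ^ (2 * H - 1) *
        (b ^ (1 / H - 1) / (1 / H - 1))) := by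
  obtain ⟨hH1, hH2⟩ := hH
  have hH0 : 0 < H := by linarith
  have hq : 0 < 1 / H - 1 := by
    rw [sub_pos, lt_div_iff₀ hH0]; linarith
  set N := ∫ t, f t ^ (1 / H) ∂μ with hN
  have hN0 : 0 ≤ N := integral_nonneg fun t => Real.rpow_nonneg (hf0 t) _
  have hk : Measurable fun t : ℝ => ENNReal.ofReal (|t - s| ^ (2 * H - 2)) := by fun_prop
  set ν := μ.withDensity fun t => ENNReal.ofReal (|t - s| ^ (2 * H - 2)) with hν
  have hC : 0 ≤ 2 / (2 * H - 1) + 1 := by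
    have : 0 < 2 * H - 1 := by linarith
    positivity
  have hlevel : ∀ a, 0 < a → ν {t | a < f t} ≤
      ENNReal.ofReal ((2 / (2 * H - 1) + 1) * N ^ (2 * H - 1) * a ^ (1 / H - 2)) := by
    intro a ha
    have hms : MeasurableSet {t | a < f t} := measurableSet_lt measurable_const hf
    have hap : 0 < a ^ (1 / H) := Real.rpow_pos_of_pos ha _
    have hsub : {t | a < f t} ⊆ {t | a ^ (1 / H) ≤ f t ^ (1 / H)} := fun t ht =>
      Real.rpow_le_rpow ha.le (le_of_lt ht) (by positivity)
    have hfin : μ {t | a ^ (1 / H) ≤ f t ^ (1 / H)} ≠ ∞ :=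
      (hint.measure_ge_lt_top hap).ne
    have hcheb := mul_meas_ge_le_integral_of_nonneg
      (Filter.Eventually.of_forall fun t => Real.rpow_nonneg (hf0 t) (1 / H)) hint (a ^ (1 / H))
    have hle : (μ {t | a < f t}).toReal ≤ N / a ^ (1 / H) := by
      rw [le_div_iff₀ hap, mul_comm]
      refine le_trans ?_ hcheb
      gcongr
      exact ENNReal.toReal_mono hfin (measure_mono hsub)
    rw [hν, withDensity_apply _ hms]
    refine (setLIntegral_abs_sub_rpow_le hμ (by linarith) (by linarith) s
      (measure_ne_top_of_subset hsub hfin)).trans (ENNReal.ofReal_le_ofReal ?_)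
    rw [show 2 * H - 2 + 1 = 2 * H - 1 by ring, mul_assoc]
    refine mul_le_mul_of_nonneg_left ?_ hC
    refine (Real.rpow_le_rpow ENNReal.toReal_nonneg hle (by linarith)).trans_eq ?_
    rw [Real.div_rpow hN0 hap.le, ← Real.rpow_mul ha.le, div_eq_mul_inv, ← Real.rpow_neg ha.le]
    congr 2
    field_simp
    ring
  calc ∫⁻ t, ENNReal.ofReal (|t - s| ^ (2 * H - 2)) * ENNReal.ofReal (min (f t) b) ∂μ
      = ∫⁻ t, ENNReal.ofReal (min (f t) b) ∂ν := by
        rw [hν, lintegral_withDensity_eq_lintegral_mul _ hk (by fun_prop)]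
        rfl
    _ = ∫⁻ a in Set.Ioi 0, ν {t | a < min (f t) b} :=
        lintegral_eq_lintegral_meas_lt ν
          (Filter.Eventually.of_forall fun t => le_min (hf0 t) hb) (by fun_prop)
    _ ≤ ∫⁻ a in Set.Ioi 0, (Set.Ioc 0 b).indicator (fun a => ENNReal.ofReal
          ((2 / (2 * H - 1) + 1) * N ^ (2 * H - 1) * a ^ (1 / H - 2))) a := by
        refine setLIntegral_mono' measurableSet_Ioi fun a (ha : 0 < a) => ?_
        by_cases hab : a ≤ b
        · have hmem : a ∈ Set.Ioc 0 b := ⟨ha, hab⟩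
          rw [Set.indicator_of_mem hmem]
          have hsub : {t | a < min (f t) b} ⊆ {t | a < f t} := fun t ht =>
            lt_of_lt_of_le (show a < min (f t) b from ht) (min_le_left _ _)
          exact (measure_mono hsub).trans (hlevel a ha)
        · have hempty : {t | a < min (f t) b} = ∅ :=
            Set.eq_empty_of_forall_notMem fun t ht => hab (lt_min_iff.1 ht).2.le
          rw [hempty, measure_empty]
          exact zero_le
    _ ≤ ∫⁻ a in Set.Ioc 0 b, ENNReal.ofReal
          ((2 / (2 * H - 1) + 1) * N ^ (2 * H - 1) * a ^ (1 / H - 2)) := by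
        rw [← lintegral_indicator measurableSet_Ioc]
        exact setLIntegral_le_lintegral _ _
    _ = _ := by
        have hexp : -1 < 1 / H - 2 := by linarith
        have hi := (intervalIntegral.intervalIntegrable_rpow' (a := 0) (b := b) hexp).const_mul
          ((2 / (2 * H - 1) + 1) * N ^ (2 * H - 1))
        rw [intervalIntegrable_iff_integrableOn_Ioc_of_le hb] at hi
        rw [← ofReal_integral_eq_lintegral_ofReal hi, ← intervalIntegral.integral_of_le hb,
          intervalIntegral.integral_const_mul, integral_rpow (Or.inl hexp),
          show 1 / H - 2 + 1 = 1 / H - 1 by ring, Real.zero_rpow hq.ne', sub_zero]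
        filter_upwards [self_mem_ae_restrict measurableSet_Ioc] with x hx
        exact mul_nonneg (mul_nonneg hC (Real.rpow_nonneg hN0 _)) (Real.rpow_nonneg hx.1.le _)

/-- The diagonal one-dimensional Hardy–Littlewood–Sobolev inequality. -/
theorem lintegral_lintegral_mul_abs_sub_rpow_le {μ : Measure ℝ} [SFinite μ] (hμ : μ ≤ volume)
    {H : ℝ} (hH : H ∈ Set.Ioo (1 / 2 : ℝ) 1) {f : ℝ → ℝ} (hf : Measurable f)
    (hf0 : ∀ t, 0 ≤ f t) (hint : Integrable (fun t => f t ^ (1 / H)) μ) :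
    ∫⁻ t, ∫⁻ s, ENNReal.ofReal (f t * f s * |t - s| ^ (2 * H - 2)) ∂μ ∂μ ≤
      ENNReal.ofReal (2 * ((2 / (2 * H - 1) + 1) / (1 / H - 1)) *
        (∫ t, f t ^ (1 / H) ∂μ) ^ (2 * H)) := by
  have hH0 : 0 < H := by linarith [hH.1]
  have hq : 0 < 1 / H - 1 := by
    rw [sub_pos, lt_div_iff₀ hH0]; linarith [hH.2]
  have h2H : 0 < 2 * H - 1 := by linarith [hH.1]
  set N := ∫ t, f t ^ (1 / H) ∂μ with hN
  have hN0 : 0 ≤ N := integral_nonneg fun t => Real.rpow_nonneg (hf0 t) _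
  set C := (2 / (2 * H - 1) + 1) / (1 / H - 1) with hC
  have hC0 : 0 ≤ C := by positivity
  let G : ℝ → ℝ → ℝ≥0∞ := fun s t => ENNReal.ofReal (f s) *
    (ENNReal.ofReal (|t - s| ^ (2 * H - 2)) * ENNReal.ofReal (min (f t) (f s)))
  have hG : Measurable (Function.uncurry G) := by
    simp only [G, Function.uncurry_def]
    fun_prop
  have hinner : ∀ s, ∫⁻ t, G s t ∂μ ≤
      ENNReal.ofReal (C * N ^ (2 * H - 1)) * ENNReal.ofReal (f s ^ (1 / H)) := by
    intro s
    rw [lintegral_const_mul _ (by fun_prop)]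
    refine (mul_le_mul_right (lintegral_min_mul_abs_sub_rpow_le hμ hH hf hf0 hint s (hf0 s))
      _).trans_eq ?_
    rw [← ENNReal.ofReal_mul (hf0 s), ← ENNReal.ofReal_mul (by positivity)]
    congr 1
    have hpow : f s * f s ^ (1 / H - 1) = f s ^ (1 / H) := by
      rw [← Real.rpow_one_add' (hf0 s) (by simp [hH0.ne']), add_sub_cancel]
    rw [← hpow, hC]
    ring
  have hhalf : ∫⁻ s, ∫⁻ t, G s t ∂μ ∂μ ≤ ENNReal.ofReal (C * N ^ (2 * H)) := by
    refine (lintegral_mono hinner).trans_eq ?_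
    rw [lintegral_const_mul _ (by fun_prop), ← ofReal_integral_eq_lintegral_ofReal hint
      (Filter.Eventually.of_forall fun t => Real.rpow_nonneg (hf0 t) _), ← hN,
      ← ENNReal.ofReal_mul (by positivity), mul_assoc,
      ← Real.rpow_add_one' hN0 (by linarith), sub_add_cancel]
  have hpt : ∀ t s, ENNReal.ofReal (f t * f s * |t - s| ^ (2 * H - 2)) ≤ G t s + G s t := by
    intro t s
    have hm : 0 ≤ min (f t) (f s) := le_min (hf0 t) (hf0 s)
    have hk : 0 ≤ |t - s| ^ (2 * H - 2) := by positivity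
    simp only [G]
    rw [abs_sub_comm s t, min_comm (f s) (f t), ← add_mul, ← ENNReal.ofReal_mul hk,
      ← ENNReal.ofReal_add (hf0 t) (hf0 s),
      ← ENNReal.ofReal_mul (add_nonneg (hf0 t) (hf0 s))]
    refine ENNReal.ofReal_le_ofReal ?_
    rw [mul_comm (|t - s| ^ (2 * H - 2)), ← mul_assoc]
    refine mul_le_mul_of_nonneg_right ?_ hk
    rw [← max_mul_min (f t) (f s)]
    exact mul_le_mul_of_nonneg_right (max_le_add_of_nonneg (hf0 t) (hf0 s)) hm
  calc ∫⁻ t, ∫⁻ s, ENNReal.ofReal (f t * f s * |t - s| ^ (2 * H - 2)) ∂μ ∂μ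
      ≤ ∫⁻ t, ∫⁻ s, (G t s + G s t) ∂μ ∂μ :=
        lintegral_mono fun t => lintegral_mono fun s => hpt t s
    _ = ∫⁻ t, ∫⁻ s, G t s ∂μ ∂μ + ∫⁻ t, ∫⁻ s, G s t ∂μ ∂μ := by
        have hG' : Measurable fun t => ∫⁻ s, G t s ∂μ := hG.lintegral_prod_right'
        rw [← lintegral_add_left hG']
        exact lintegral_congr fun t => lintegral_add_left hG.of_uncurry_left _
    _ = ∫⁻ s, ∫⁻ t, G s t ∂μ ∂μ + ∫⁻ s, ∫⁻ t, G s t ∂μ ∂μ := by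
        rw [lintegral_lintegral_swap (f := fun t s => G s t) (hG.comp measurable_swap).aemeasurable]
    _ ≤ _ := by
        refine (add_le_add hhalf hhalf).trans_eq ?_
        rw [← ENNReal.ofReal_add (by positivity) (by positivity)]
        congr 1
        ring

/-- There exists a constant `b_H > 0` depending only on `H` such that for every
`T > 0`, every Banach space `V`, and every strongly measurable `φ : [0,T] → V` with
`∫_0^T ‖φ(t)‖^{1/H} dt < ∞`, one has
`H(2H-1) ∫_0^T ∫_0^T ‖φ(t)‖ ‖φ(s)‖ |t-s|^{2H-2} ds dt ≤ b_H^2 (∫_0^T ‖φ(t)‖^{1/H} dt)^{2H}`. -/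
theorem fbm_norm_comparison (H : ℝ) (hH : H ∈ Set.Ioo (1/2 : ℝ) 1) :
    ∃ b : ℝ, 0 < b ∧
      ∀ (T : ℝ), 0 < T →
      ∀ (V : Type) [NormedAddCommGroup V] [NormedSpace ℝ V] [CompleteSpace V]
        (φ : ℝ → V), StronglyMeasurable φ →
        IntegrableOn (fun t => ‖φ t‖ ^ (1/H)) (Set.Icc 0 T) →
        ENNReal.ofReal (H * (2*H - 1)) *
            ∫⁻ t in Set.Icc (0:ℝ) T, ∫⁻ s in Set.Icc (0:ℝ) T,
              ENNReal.ofReal (‖φ t‖ * ‖φ s‖ * |t - s| ^ (2*H - 2)) ≤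
          ENNReal.ofReal (b^2 * (∫ t in Set.Icc (0:ℝ) T, ‖φ t‖ ^ (1/H)) ^ (2*H)) := by
  have hH0 : 0 < H := by linarith [hH.1]
  have hq : 0 < 1 / H - 1 := by
    rw [sub_pos, lt_div_iff₀ hH0]; linarith [hH.2]
  have h2H : 0 < 2 * H - 1 := by linarith [hH.1]
  have hα : 0 < H * (2 * H - 1) := mul_pos hH0 h2H
  set C := H * (2 * H - 1) * (2 * ((2 / (2 * H - 1) + 1) / (1 / H - 1))) with hC
  have hC0 : 0 < C := by positivity
  refine ⟨√C, Real.sqrt_pos.2 hC0, fun T _ V _ _ _ φ hφ hint => ?_⟩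
  refine (mul_le_mul_right (lintegral_lintegral_mul_abs_sub_rpow_le Measure.restrict_le_self hH
    hφ.norm.measurable (fun t => norm_nonneg _) hint) _).trans_eq ?_
  rw [← ENNReal.ofReal_mul hα.le, Real.sq_sqrt hC0.le, hC, mul_assoc (H * (2 * H - 1))]
end

section
/- There exists a constant $b_H>0$ depending only on $H$ such that for every $T>0$, every Banach space $W$, and every strongly measurable function $\phi:[0,T]^2\to W$ with $\int_0^T\int_0^T \|\phi(t,\theta)\|_W^{1/H}\,d\theta\,dt<\infty$, one has $(H(2H-1))^2\int_{[0,T]^4} \|\phi(t,\theta)\|_W\,\|\phi(s,\eta)\|_W\,|t-s|^{2H-2}\,|\theta-\eta|^{2H-2}\,d\theta\,d\eta\,ds\,dt \;\le\; b_H^2\left(\int_0^T\int_0^T \|\phi(t,\theta)\|_W^{1/H}\,d\theta\,dt\right)^{2H}.$ -/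
open MeasureTheory ENNReal

theorem lintegral_comp_abs (f : ℝ → ℝ≥0∞) :
    ∫⁻ x : ℝ, f |x| = 2 * ∫⁻ x in Set.Ioi (0 : ℝ), f x := by
  have hpos : ∫⁻ x in Set.Ioi (0 : ℝ), f |x| = ∫⁻ x in Set.Ioi (0 : ℝ), f x :=
    setLIntegral_congr_fun measurableSet_Ioi fun x (hx : 0 < x) => by simp only [abs_of_pos hx]
  have hneg : ∫⁻ x in Set.Iic (0 : ℝ), f |x| = ∫⁻ x in Set.Ioi (0 : ℝ), f |x| := by
    rw [← setLIntegral_congr (Iio_ae_eq_Iic (μ := volume) (a := (0 : ℝ))),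
      ← lintegral_indicator measurableSet_Iio, ← lintegral_indicator measurableSet_Ioi,
      ← lintegral_neg_eq_self]
    congr with x
    simp [Set.indicator]
  rw [← lintegral_add_compl _ (measurableSet_Ioi (a := (0 : ℝ))), Set.compl_Ioi, hneg, hpos,
    two_mul]

theorem setLIntegral_abs_sub (f : ℝ → ℝ≥0∞) (t : ℝ) {S : Set ℝ} (hS : MeasurableSet S) :
    ∫⁻ s in {s | |t - s| ∈ S}, f |t - s| = 2 * ∫⁻ x in S ∩ Set.Ioi 0, f x := by
  have hS' : MeasurableSet {s | |t - s| ∈ S} := by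
    have : Measurable fun s : ℝ => |t - s| := by fun_prop
    exact this hS
  calc ∫⁻ s in {s | |t - s| ∈ S}, f |t - s|
      = ∫⁻ s, S.indicator f |t - s| := by
        rw [← lintegral_indicator hS']
        congr
    _ = ∫⁻ x, S.indicator f |x| :=
        lintegral_sub_left_eq_self (fun x : ℝ => S.indicator f |x|) t
    _ = 2 * ∫⁻ x in S ∩ Set.Ioi 0, f x := by
        rw [lintegral_comp_abs, setLIntegral_indicator hS]

theorem setLIntegral_abs_sub_rpow_near {r R : ℝ} (hr : -1 < r) (hR : 0 < R) (t : ℝ) :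
    ∫⁻ s in {s | |t - s| ∈ Set.Iic R}, ENNReal.ofReal (|t - s| ^ r) =
      ENNReal.ofReal (2 / (r + 1) * R ^ (r + 1)) := by
  rw [setLIntegral_abs_sub (fun x => ENNReal.ofReal (x ^ r)) t measurableSet_Iic,
    Set.inter_comm, Set.Ioi_inter_Iic, ← ofReal_integral_eq_lintegral_ofReal
      ((intervalIntegrable_iff_integrableOn_Ioc_of_le hR.le).1
        (intervalIntegral.intervalIntegrable_rpow' hr))
      (ae_restrict_of_forall_mem measurableSet_Ioc fun x hx => Real.rpow_nonneg hx.1.le _),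
    ← intervalIntegral.integral_of_le hR.le, integral_rpow (Or.inl hr),
    Real.zero_rpow (by linarith), ← ENNReal.ofReal_ofNat 2, ← ENNReal.ofReal_mul zero_le_two]
  congr 1
  ring

theorem setLIntegral_abs_sub_rpow_far {r R : ℝ} (hr : r < -1) (hR : 0 < R) (t : ℝ) :
    ∫⁻ s in {s | |t - s| ∈ Set.Ioi R}, ENNReal.ofReal (|t - s| ^ r) =
      ENNReal.ofReal (2 / (-(r + 1)) * R ^ (r + 1)) := by
  rw [setLIntegral_abs_sub (fun x => ENNReal.ofReal (x ^ r)) t measurableSet_Ioi,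
    Set.inter_eq_left.2 (Set.Ioi_subset_Ioi hR.le), ← ofReal_integral_eq_lintegral_ofReal
      (integrableOn_Ioi_rpow_of_lt hr hR)
      (ae_restrict_of_forall_mem measurableSet_Ioi fun x hx =>
        Real.rpow_nonneg (hR.trans hx).le _),
    integral_Ioi_rpow_of_lt hr hR, ← ENNReal.ofReal_ofNat 2, ← ENNReal.ofReal_mul zero_le_two]
  congr 1
  rw [div_neg]
  ring

/-- The constant in the one-dimensional Hardy–Littlewood–Sobolev inequality below. -/
noncomputable def hlsConst (H : ℝ) : ℝ := 2 / (2 * H - 1) + 2 ^ (1 - H)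

theorem hlsConst_pos {H : ℝ} (hH : H ∈ Set.Ioo (1 / 2 : ℝ) 1) : 0 < hlsConst H := by
  have : 0 < 2 * H - 1 := by linarith [hH.1]
  unfold hlsConst
  positivity

/-- Pointwise bound on the Riesz potential of the part of `g` lying below the level `a`. -/
theorem mul_setLIntegral_rieszKernel_le {H : ℝ} (hH : H ∈ Set.Ioo (1 / 2 : ℝ) 1) {μ : Measure ℝ}
    (hμ : μ ≤ volume) {g : ℝ → ℝ≥0∞} (hg : Measurable g) (hg1 : ∫⁻ s, g s ^ (1 / H) ∂μ ≤ 1)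
    (t : ℝ) (a : ℝ≥0∞) :
    a * ∫⁻ s in {s | g s ≤ a}, g s * ENNReal.ofReal (|t - s| ^ (2 * H - 2)) ∂μ ≤
      ENNReal.ofReal (hlsConst H) * a ^ (1 / H) := by
  obtain ⟨hH1, hH2⟩ := hH
  have hH0 : 0 < H := by linarith
  rcases eq_or_ne a 0 with rfl | ha0
  · simp
  rcases eq_or_ne a ∞ with rfl | hat
  · rw [ENNReal.top_rpow_of_pos (by positivity),
      ENNReal.mul_top (ENNReal.ofReal_pos.2 (hlsConst_pos ⟨hH1, hH2⟩)).ne']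
    exact le_top
  obtain ⟨x, hx, rfl⟩ : ∃ x : ℝ, 0 < x ∧ ENNReal.ofReal x = a :=
    ⟨a.toReal, ENNReal.toReal_pos ha0 hat, ENNReal.ofReal_toReal hat⟩
  set R : ℝ := x ^ (-(1 / H)) with hRdef
  have hR : 0 < R := by positivity
  have habs : Measurable fun s : ℝ => |t - s| := by fun_prop
  have hk : Measurable fun s : ℝ => ENNReal.ofReal (|t - s| ^ (2 * H - 2)) := by fun_prop
  have hnear : MeasurableSet {s | |t - s| ∈ Set.Iic R} := habs measurableSet_Iic
  have hlow : MeasurableSet {s | g s ≤ ENNReal.ofReal x} := measurableSet_le hg measurable_const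
  have near : ∫⁻ s in {s | g s ≤ ENNReal.ofReal x} ∩ {s | |t - s| ∈ Set.Iic R},
      g s * ENNReal.ofReal (|t - s| ^ (2 * H - 2)) ∂μ ≤
        ENNReal.ofReal (2 / (2 * H - 1) * x ^ (1 / H - 1)) :=
    calc _ ≤ ∫⁻ s in {s | g s ≤ ENNReal.ofReal x} ∩ {s | |t - s| ∈ Set.Iic R},
          ENNReal.ofReal x * ENNReal.ofReal (|t - s| ^ (2 * H - 2)) ∂μ :=
          setLIntegral_mono' (hlow.inter hnear) fun s hs => mul_le_mul_left hs.1 _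
      _ ≤ ∫⁻ s in {s | |t - s| ∈ Set.Iic R},
          ENNReal.ofReal x * ENNReal.ofReal (|t - s| ^ (2 * H - 2)) :=
          lintegral_mono' (Measure.restrict_mono Set.inter_subset_right hμ) le_rfl
      _ = ENNReal.ofReal (2 / (2 * H - 1) * x ^ (1 / H - 1)) := by
          rw [lintegral_const_mul _ hk, setLIntegral_abs_sub_rpow_near (by linarith) hR,
            ← ENNReal.ofReal_mul hx.le, hRdef, ← Real.rpow_mul hx.le,
            show 2 * H - 2 + 1 = 2 * H - 1 by ring, mul_left_comm]
          congr 2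
          nth_rw 1 [← Real.rpow_one x]
          rw [← Real.rpow_add hx]
          congr 1
          field_simp
          ring
  have hpq : (1 / H).HolderConjugate (1 / (1 - H)) := by
    rw [Real.holderConjugate_iff]
    refine ⟨by rw [lt_div_iff₀ hH0]; linarith, by simp⟩
  have far : ∫⁻ s in {s | g s ≤ ENNReal.ofReal x} \ {s | |t - s| ∈ Set.Iic R},
      g s * ENNReal.ofReal (|t - s| ^ (2 * H - 2)) ∂μ ≤
        ENNReal.ofReal (2 ^ (1 - H) * x ^ (1 / H - 1)) :=
    calc _ ≤ ∫⁻ s in {s | |t - s| ∈ Set.Ioi R},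
          g s * ENNReal.ofReal (|t - s| ^ (2 * H - 2)) ∂μ :=
          lintegral_mono_set fun s hs =>
            Set.mem_Ioi.2 (not_le.1 (show ¬|t - s| ≤ R from hs.2))
      _ ≤ (∫⁻ s in {s | |t - s| ∈ Set.Ioi R}, g s ^ (1 / H) ∂μ) ^ (1 / (1 / H)) *
          (∫⁻ s in {s | |t - s| ∈ Set.Ioi R},
            ENNReal.ofReal (|t - s| ^ (2 * H - 2)) ^ (1 / (1 - H)) ∂μ) ^ (1 / (1 / (1 - H))) :=
          ENNReal.lintegral_mul_le_Lp_mul_Lq _ hpq hg.aemeasurable hk.aemeasurable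
      _ ≤ 1 * (∫⁻ s in {s | |t - s| ∈ Set.Ioi R},
            ENNReal.ofReal (|t - s| ^ (-2 : ℝ))) ^ (1 / (1 / (1 - H))) := by
          have h1H : 0 < 1 - H := by linarith
          refine mul_le_mul' ?_ (ENNReal.rpow_le_rpow ?_ (by positivity))
          · refine (ENNReal.rpow_le_rpow ((setLIntegral_le_lintegral _ _).trans hg1)
              (by positivity)).trans_eq (ENNReal.one_rpow _)
          · refine lintegral_mono' (Measure.restrict_mono le_rfl hμ) ?_
            intro s
            simp only
            rw [ENNReal.ofReal_rpow_of_nonneg (by positivity) (by positivity),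
              ← Real.rpow_mul (abs_nonneg _)]
            refine le_of_eq ?_
            congr 2
            field_simp
            ring
      _ = ENNReal.ofReal (2 ^ (1 - H) * x ^ (1 / H - 1)) := by
          rw [one_mul, setLIntegral_abs_sub_rpow_far (by norm_num) hR, one_div_one_div,
            ENNReal.ofReal_rpow_of_nonneg (by norm_num; positivity) (by linarith)]
          congr 1
          rw [Real.mul_rpow (by norm_num) (by positivity), hRdef, ← Real.rpow_mul hx.le,
            ← Real.rpow_mul hx.le]
          congr 2
          · norm_num
          · field_simp
            ring
  calc _ = ENNReal.ofReal x *
        (∫⁻ s in {s | g s ≤ ENNReal.ofReal x} ∩ {s | |t - s| ∈ Set.Iic R},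
          g s * ENNReal.ofReal (|t - s| ^ (2 * H - 2)) ∂μ +
        ∫⁻ s in {s | g s ≤ ENNReal.ofReal x} \ {s | |t - s| ∈ Set.Iic R},
          g s * ENNReal.ofReal (|t - s| ^ (2 * H - 2)) ∂μ) := by
        rw [lintegral_inter_add_sdiff _ _ hnear]
    _ ≤ ENNReal.ofReal x * (ENNReal.ofReal (2 / (2 * H - 1) * x ^ (1 / H - 1)) +
          ENNReal.ofReal (2 ^ (1 - H) * x ^ (1 / H - 1))) := by gcongr
    _ = ENNReal.ofReal (hlsConst H) * ENNReal.ofReal x ^ (1 / H) := by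
        have : 0 < 2 * H - 1 := by linarith
        rw [← ENNReal.ofReal_add (by positivity) (by positivity), ← ENNReal.ofReal_mul hx.le,
          ENNReal.ofReal_rpow_of_pos hx, ← ENNReal.ofReal_mul (hlsConst_pos ⟨hH1, hH2⟩).le,
          hlsConst, Real.rpow_sub_one hx.ne']
        congr 1
        field_simp

theorem lintegral_lintegral_rieszKernel_le_of_le_one {H : ℝ} (hH : H ∈ Set.Ioo (1 / 2 : ℝ) 1)
    {μ : Measure ℝ} [SFinite μ] (hμ : μ ≤ volume) {f g : ℝ → ℝ≥0∞} (hf : Measurable f)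
    (hg : Measurable g) (hf1 : ∫⁻ s, f s ^ (1 / H) ∂μ ≤ 1) (hg1 : ∫⁻ s, g s ^ (1 / H) ∂μ ≤ 1) :
    ∫⁻ t, ∫⁻ s, f t * g s * ENNReal.ofReal (|t - s| ^ (2 * H - 2)) ∂μ ∂μ ≤
      2 * ENNReal.ofReal (hlsConst H) := by
  have half : ∀ u v : ℝ → ℝ≥0∞, Measurable u → Measurable v → ∫⁻ s, u s ^ (1 / H) ∂μ ≤ 1 →
      ∫⁻ s, v s ^ (1 / H) ∂μ ≤ 1 →
      ∫⁻ t, ∫⁻ s, (if v s ≤ u t then u t * (v s * ENNReal.ofReal (|t - s| ^ (2 * H - 2))) else 0)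
        ∂μ ∂μ ≤ ENNReal.ofReal (hlsConst H) := by
    intro u v hu hv hu1 hv1
    calc _ ≤ ∫⁻ t, ENNReal.ofReal (hlsConst H) * u t ^ (1 / H) ∂μ := by
          refine lintegral_mono fun t => ?_
          refine le_trans (le_of_eq ?_) (mul_setLIntegral_rieszKernel_le hH hμ hv hv1 t (u t))
          rw [← lintegral_const_mul _ (by fun_prop),
            ← lintegral_indicator (measurableSet_le hv measurable_const)]
          refine lintegral_congr fun s => ?_
          simp [Set.indicator]
      _ = ENNReal.ofReal (hlsConst H) * ∫⁻ t, u t ^ (1 / H) ∂μ :=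
          lintegral_const_mul _ (by fun_prop)
      _ ≤ ENNReal.ofReal (hlsConst H) := mul_le_of_le_one_right' hu1
  have hmeas : ∀ u v : ℝ → ℝ≥0∞, Measurable u → Measurable v → Measurable fun q : ℝ × ℝ =>
      if v q.2 ≤ u q.1 then u q.1 * (v q.2 * ENNReal.ofReal (|q.1 - q.2| ^ (2 * H - 2))) else 0 :=
    fun u v hu hv => Measurable.ite (measurableSet_le (by fun_prop) (by fun_prop))
      (by fun_prop) measurable_const
  calc _ ≤ ∫⁻ t, ∫⁻ s,
        ((if g s ≤ f t then f t * (g s * ENNReal.ofReal (|t - s| ^ (2 * H - 2))) else 0) +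
          if f t ≤ g s then g s * (f t * ENNReal.ofReal (|s - t| ^ (2 * H - 2))) else 0) ∂μ ∂μ := by
        refine lintegral_mono fun t => lintegral_mono fun s => ?_
        simp only
        rcases le_total (g s) (f t) with h | h
        · rw [if_pos h, ← mul_assoc]
          exact le_self_add
        · rw [if_pos h]
          refine le_trans (le_of_eq ?_) (le_add_of_nonneg_left (bot_le (α := ℝ≥0∞)))
          rw [abs_sub_comm s]
          ring
    _ = (∫⁻ t, ∫⁻ s,
          (if g s ≤ f t then f t * (g s * ENNReal.ofReal (|t - s| ^ (2 * H - 2))) else 0) ∂μ ∂μ) +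
        ∫⁻ t, ∫⁻ s,
          (if f t ≤ g s then g s * (f t * ENNReal.ofReal (|s - t| ^ (2 * H - 2))) else 0) ∂μ ∂μ := by
        rw [← lintegral_add_left (hmeas f g hf hg).lintegral_prod_right']
        refine lintegral_congr fun t => ?_
        exact lintegral_add_left ((hmeas f g hf hg).comp measurable_prodMk_left) _
    _ ≤ ENNReal.ofReal (hlsConst H) + ENNReal.ofReal (hlsConst H) := by
        refine add_le_add (half f g hf hg hf1 hg1) ?_
        exact (lintegral_lintegral_swap (f := fun t s => if f t ≤ g s then
            g s * (f t * ENNReal.ofReal (|s - t| ^ (2 * H - 2))) else 0)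
          ((hmeas g f hg hf).comp measurable_swap).aemeasurable).trans_le
          (half g f hg hf hg1 hf1)
    _ = _ := (two_mul _).symm

/-- One-dimensional Hardy–Littlewood–Sobolev inequality in the symmetric case. -/
theorem lintegral_lintegral_rieszKernel_le {H : ℝ} (hH : H ∈ Set.Ioo (1 / 2 : ℝ) 1)
    {μ : Measure ℝ} [SFinite μ] (hμ : μ ≤ volume) {f g : ℝ → ℝ≥0∞} (hf : Measurable f)
    (hg : Measurable g) :
    ∫⁻ t, ∫⁻ s, f t * g s * ENNReal.ofReal (|t - s| ^ (2 * H - 2)) ∂μ ∂μ ≤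
      2 * ENNReal.ofReal (hlsConst H) *
        ((∫⁻ s, f s ^ (1 / H) ∂μ) ^ H * (∫⁻ s, g s ^ (1 / H) ∂μ) ^ H) := by
  have hH0 : 0 < H := by linarith [hH.1]
  have hC : 2 * ENNReal.ofReal (hlsConst H) ≠ 0 :=
    mul_ne_zero two_ne_zero (ENNReal.ofReal_pos.2 (hlsConst_pos hH)).ne'
  have hzero : ∀ u : ℝ → ℝ≥0∞, Measurable u → (∫⁻ s, u s ^ (1 / H) ∂μ) ^ H = 0 →
      u =ᵐ[μ] 0 := by
    intro u hu h
    rw [ENNReal.rpow_eq_zero_iff_of_pos hH0, lintegral_eq_zero_iff (by fun_prop)] at h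
    filter_upwards [h] with s hs
    exact (ENNReal.rpow_eq_zero_iff_of_pos (by positivity)).1 hs
  have hnorm : ∀ u : ℝ → ℝ≥0∞, Measurable u → (∫⁻ s, u s ^ (1 / H) ∂μ) ^ H ≠ 0 →
      (∫⁻ s, u s ^ (1 / H) ∂μ) ^ H ≠ ∞ →
      ∫⁻ s, (((∫⁻ s, u s ^ (1 / H) ∂μ) ^ H)⁻¹ * u s) ^ (1 / H) ∂μ ≤ 1 := by
    intro u hu h0 ht
    have h0' : ∫⁻ s, u s ^ (1 / H) ∂μ ≠ 0 := fun h => h0 (by rw [h, ENNReal.zero_rpow_of_pos hH0])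
    have ht' : ∫⁻ s, u s ^ (1 / H) ∂μ ≠ ∞ := fun h => ht (by rw [h, ENNReal.top_rpow_of_pos hH0])
    simp_rw [ENNReal.mul_rpow_of_nonneg _ _ (one_div_pos.2 hH0).le]
    rw [lintegral_const_mul _ (by fun_prop), ENNReal.inv_rpow, ← ENNReal.rpow_mul,
      mul_one_div_cancel hH0.ne', ENNReal.rpow_one, ENNReal.inv_mul_cancel h0' ht']
  set A := (∫⁻ s, f s ^ (1 / H) ∂μ) ^ H with hA
  set B := (∫⁻ s, g s ^ (1 / H) ∂μ) ^ H with hB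
  rcases eq_or_ne A 0 with hA0 | hA0
  · refine le_of_eq_of_le ?_ zero_le
    refine (lintegral_congr_ae ?_).trans lintegral_zero
    filter_upwards [hzero f hf hA0] with t ht
    simp [ht]
  rcases eq_or_ne B 0 with hB0 | hB0
  · refine le_of_eq_of_le ?_ zero_le
    refine (lintegral_congr fun t => ?_).trans lintegral_zero
    refine (lintegral_congr_ae ?_).trans lintegral_zero
    filter_upwards [hzero g hg hB0] with s hs
    simp [hs]
  rcases eq_or_ne A ∞ with hAt | hAt
  · rw [hAt, ENNReal.top_mul hB0, ENNReal.mul_top hC]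
    exact le_top
  rcases eq_or_ne B ∞ with hBt | hBt
  · rw [hBt, ENNReal.mul_top hA0, ENNReal.mul_top hC]
    exact le_top
  have hmeas : Measurable fun q : ℝ × ℝ =>
      A⁻¹ * f q.1 * (B⁻¹ * g q.2) * ENNReal.ofReal (|q.1 - q.2| ^ (2 * H - 2)) := by fun_prop
  calc _ = ∫⁻ t, ∫⁻ s, A * B * (A⁻¹ * f t * (B⁻¹ * g s) *
          ENNReal.ofReal (|t - s| ^ (2 * H - 2))) ∂μ ∂μ := by
        refine lintegral_congr fun t => lintegral_congr fun s => ?_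
        calc _ = (A * A⁻¹) * (B * B⁻¹) *
              (f t * g s * ENNReal.ofReal (|t - s| ^ (2 * H - 2))) := by
              rw [ENNReal.mul_inv_cancel hA0 hAt, ENNReal.mul_inv_cancel hB0 hBt, one_mul, one_mul]
          _ = _ := by ring
    _ = A * B * ∫⁻ t, ∫⁻ s, A⁻¹ * f t * (B⁻¹ * g s) *
          ENNReal.ofReal (|t - s| ^ (2 * H - 2)) ∂μ ∂μ := by
        rw [← lintegral_const_mul _ hmeas.lintegral_prod_right']
        refine lintegral_congr fun t => ?_
        exact lintegral_const_mul _ (hmeas.comp measurable_prodMk_left)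
    _ ≤ A * B * (2 * ENNReal.ofReal (hlsConst H)) := by
        gcongr
        exact lintegral_lintegral_rieszKernel_le_of_le_one hH hμ (by fun_prop) (by fun_prop)
          (hnorm f hf hA0 hAt) (hnorm g hg hB0 hBt)
    _ = _ := mul_comm _ _

theorem lintegral_rieszKernel_prod_le {H : ℝ} (hH : H ∈ Set.Ioo (1 / 2 : ℝ) 1)
    {μ : Measure ℝ} [SFinite μ] (hμ : μ ≤ volume) {f : ℝ × ℝ → ℝ≥0∞} (hf : Measurable f) :
    ∫⁻ t, ∫⁻ s, ∫⁻ θ, ∫⁻ η, f (t, θ) * f (s, η) * ENNReal.ofReal (|t - s| ^ (2 * H - 2)) *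
        ENNReal.ofReal (|θ - η| ^ (2 * H - 2)) ∂μ ∂μ ∂μ ∂μ ≤
      (2 * ENNReal.ofReal (hlsConst H)) ^ 2 * (∫⁻ q, f q ^ (1 / H) ∂μ.prod μ) ^ (2 * H) := by
  have hH0 : 0 < H := by linarith [hH.1]
  have hfp : Measurable fun q => f q ^ (1 / H) := by fun_prop
  set C := 2 * ENNReal.ofReal (hlsConst H)
  set N : ℝ → ℝ≥0∞ := fun t => (∫⁻ θ, f (t, θ) ^ (1 / H) ∂μ) ^ H with hN
  have hNm : Measurable N := hfp.lintegral_prod_right'.pow_const H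
  have hslice : ∀ t, Measurable fun θ => f (t, θ) := fun t => hf.comp measurable_prodMk_left
  have hNN : Measurable fun q : ℝ × ℝ =>
      N q.1 * N q.2 * ENNReal.ofReal (|q.1 - q.2| ^ (2 * H - 2)) := by fun_prop
  calc _ ≤ ∫⁻ t, ∫⁻ s, C * (N t * N s * ENNReal.ofReal (|t - s| ^ (2 * H - 2))) ∂μ ∂μ := by
        refine lintegral_mono fun t => lintegral_mono fun s => ?_
        have ht := hslice t
        have hs := hslice s
        have hm : Measurable fun q : ℝ × ℝ =>
            f (t, q.1) * f (s, q.2) * ENNReal.ofReal (|q.1 - q.2| ^ (2 * H - 2)) := by fun_prop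
        calc _ = ENNReal.ofReal (|t - s| ^ (2 * H - 2)) * ∫⁻ θ, ∫⁻ η, f (t, θ) * f (s, η) *
              ENNReal.ofReal (|θ - η| ^ (2 * H - 2)) ∂μ ∂μ := by
              rw [← lintegral_const_mul _ hm.lintegral_prod_right']
              refine lintegral_congr fun θ => ?_
              refine Eq.trans ?_ (lintegral_const_mul _ (hm.comp measurable_prodMk_left))
              refine lintegral_congr fun η => ?_
              simp only
              ring
          _ ≤ ENNReal.ofReal (|t - s| ^ (2 * H - 2)) * (C * (N t * N s)) := by
              gcongr
              exact lintegral_lintegral_rieszKernel_le hH hμ ht hs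
          _ = _ := by ring
    _ = C * ∫⁻ t, ∫⁻ s, N t * N s * ENNReal.ofReal (|t - s| ^ (2 * H - 2)) ∂μ ∂μ := by
        rw [← lintegral_const_mul _ hNN.lintegral_prod_right']
        refine lintegral_congr fun t => ?_
        exact lintegral_const_mul _ (hNN.comp measurable_prodMk_left)
    _ ≤ C * (C * ((∫⁻ s, N s ^ (1 / H) ∂μ) ^ H * (∫⁻ s, N s ^ (1 / H) ∂μ) ^ H)) := by
        gcongr
        exact lintegral_lintegral_rieszKernel_le hH hμ hNm hNm
    _ = _ := by
        have hNp : ∀ s, N s ^ (1 / H) = ∫⁻ θ, f (s, θ) ^ (1 / H) ∂μ := fun s => by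
          rw [hN, ← ENNReal.rpow_mul, mul_one_div_cancel hH0.ne', ENNReal.rpow_one]
        simp_rw [hNp]
        rw [← lintegral_prod _ hfp.aemeasurable, ← ENNReal.rpow_add_of_nonneg _ _ hH0.le hH0.le,
          ← two_mul, ← mul_assoc, sq]

/-- There exists a constant `b_H > 0` depending only on `H` such that for every
`T > 0`, every Banach space `W`, and every strongly measurable `φ : [0,T]² → W` with
`∫_0^T ∫_0^T ‖φ(t,θ)‖^{1/H} dθ dt < ∞`, one has
`(H(2H-1))² ∫_{[0,T]^4} ‖φ(t,θ)‖ ‖φ(s,η)‖ |t-s|^{2H-2} |θ-η|^{2H-2} dθ dη ds dt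
  ≤ b_H² (∫_0^T ∫_0^T ‖φ(t,θ)‖^{1/H} dθ dt)^{2H}`. -/
theorem fbm_two_parameter_norm_comparison (H : ℝ) (hH : H ∈ Set.Ioo (1/2 : ℝ) 1) :
    ∃ b : ℝ, 0 < b ∧
      ∀ (T : ℝ), 0 < T →
      ∀ (W : Type) [NormedAddCommGroup W] [NormedSpace ℝ W] [CompleteSpace W]
        (φ : ℝ × ℝ → W), StronglyMeasurable φ →
        IntegrableOn (fun q : ℝ × ℝ => ‖φ q‖ ^ (1/H))
          (Set.Icc 0 T ×ˢ Set.Icc 0 T) →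
        ENNReal.ofReal ((H * (2*H - 1))^2) *
            ∫⁻ t in Set.Icc (0:ℝ) T, ∫⁻ s in Set.Icc (0:ℝ) T,
              ∫⁻ θ in Set.Icc (0:ℝ) T, ∫⁻ η in Set.Icc (0:ℝ) T,
                ENNReal.ofReal (‖φ (t, θ)‖ * ‖φ (s, η)‖ *
                  |t - s| ^ (2*H - 2) * |θ - η| ^ (2*H - 2)) ≤
          ENNReal.ofReal (b^2 *
            (∫ q in Set.Icc (0:ℝ) T ×ˢ Set.Icc (0:ℝ) T, ‖φ q‖ ^ (1/H)) ^ (2*H)) := by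
  have hH0 : 0 < H := by linarith [hH.1]
  have hH1 : 0 < 2 * H - 1 := by linarith [hH.1]
  have hC := hlsConst_pos hH
  refine ⟨H * (2 * H - 1) * (2 * hlsConst H), by positivity, ?_⟩
  intro T _ W _ _ _ φ hφ hint
  have hI : (0 : ℝ) ≤ ∫ q in Set.Icc (0:ℝ) T ×ˢ Set.Icc (0:ℝ) T, ‖φ q‖ ^ (1/H) :=
    integral_nonneg fun q => by positivity
  have key := lintegral_rieszKernel_prod_le hH
    (Measure.restrict_le_self (μ := volume) (s := Set.Icc (0 : ℝ) T)) hφ.enorm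
  have hnorm : ∫⁻ q, ‖φ q‖ₑ ^ (1 / H)
      ∂((volume.restrict (Set.Icc (0 : ℝ) T)).prod (volume.restrict (Set.Icc (0 : ℝ) T))) =
      ENNReal.ofReal (∫ q in Set.Icc (0:ℝ) T ×ˢ Set.Icc (0:ℝ) T, ‖φ q‖ ^ (1/H)) := by
    rw [ofReal_integral_eq_lintegral_ofReal hint
      (Filter.Eventually.of_forall fun q => by positivity), Measure.prod_restrict,
      Measure.volume_eq_prod]
    refine lintegral_congr fun q => ?_
    rw [← ofReal_norm, ENNReal.ofReal_rpow_of_nonneg (norm_nonneg _) (by positivity)]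
  rw [hnorm] at key
  calc _ = ENNReal.ofReal ((H * (2*H - 1))^2) *
        ∫⁻ t in Set.Icc (0:ℝ) T, ∫⁻ s in Set.Icc (0:ℝ) T,
          ∫⁻ θ in Set.Icc (0:ℝ) T, ∫⁻ η in Set.Icc (0:ℝ) T,
            ‖φ (t, θ)‖ₑ * ‖φ (s, η)‖ₑ * ENNReal.ofReal (|t - s| ^ (2 * H - 2)) *
              ENNReal.ofReal (|θ - η| ^ (2 * H - 2)) := by
        congr 1
        refine lintegral_congr fun t => lintegral_congr fun s => lintegral_congr fun θ =>
          lintegral_congr fun η => ?_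
        rw [ENNReal.ofReal_mul (by positivity), ENNReal.ofReal_mul (by positivity),
          ENNReal.ofReal_mul (by positivity), ofReal_norm, ofReal_norm]
    _ ≤ _ := mul_le_mul_right key _
    _ = _ := by
        rw [ENNReal.ofReal_rpow_of_nonneg hI (by positivity), ← ENNReal.ofReal_ofNat 2,
          ← ENNReal.ofReal_mul zero_le_two, ← ENNReal.ofReal_pow (by positivity),
          ← ENNReal.ofReal_mul (by positivity), ← ENNReal.ofReal_mul (by positivity)]
        congr 1
        ring
end
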